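/- arXiv:2503.02944 — 5 statements merged into one kernel-verified Lean document; each statement's English description precedes it below -/
import Mathlib

section
/- Associativity of the extension product: assume (X-int): x·θ(a) = θ(θ(a))·x for all a ∈ N, and (Assoc): θ(x)·x = x·x. Then the product a ∘ b := a·θ(b)·x on N is associative: (a ∘ b) ∘ c = a ∘ (b ∘ c) for all a, b, c ∈ N. (This is the paper's verification that the Q-system condition θ(x)x = x² ensures associativity of the extension algebra M_A, whose elements i_A(n)v multiply as (i_A(n₁)v)(i_A(n₂)v) = i_A(n₁θ(n₂)x)v.) -/
/-- The extension product on `N`: `a ∘ b := a·θ(b)·x`. -/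
def extMul {N : Type*} [Ring N] (θ : N →+* N) (x : N) (a b : N) : N :=
  a * θ b * x

/-- Associativity of the extension product: assuming (X-int) `x·θ(a) = θ(θ(a))·x`
and (Assoc) `θ(x)·x = x·x`, the product `a ∘ b := a·θ(b)·x` is associative. -/
theorem qsystem_extMul_assoc {N : Type*} [Ring N] [StarRing N]
    (θ : N →+* N) (hθ : ∀ a : N, θ (star a) = star (θ a))
    (w x : N)
    (hXint : ∀ a : N, x * θ a = θ (θ a) * x)
    (hAssoc : θ x * x = x * x) :
    ∀ a b c : N, extMul θ x (extMul θ x a b) c = extMul θ x a (extMul θ x b c) := by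
  intro a b c
  simp only [extMul, map_mul]
  calc a * θ b * x * θ c * x = a * θ b * (x * θ c) * x := by simp only [mul_assoc]
    _ = a * θ b * θ (θ c) * (x * x) := by rw [hXint]; simp only [mul_assoc]
    _ = a * (θ b * θ (θ c) * θ x) * x := by rw [← hAssoc]; simp only [mul_assoc]
end

section
/- First involution computation in the Q-system extension: assume (X-int): x·θ(a) = θ(θ(a))·x for all a ∈ N, and (Assoc): θ(x)·x = x·x. Then x*·θ(x*·θ(a)·b) = x*·θ(a)·x*·θ(b) for all a, b ∈ N. (This is the paper's direct evaluation of the adjoint [(i_A(n₁)v)(i_A(n₂)v)]* in M_A.) -/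
/-- First involution computation in the Q-system extension: assuming
(X-int) `x·θ(a) = θ(θ(a))·x` and (Assoc) `θ(x)·x = x·x`, we have
`x*·θ(x*·θ(a)·b) = x*·θ(a)·x*·θ(b)` for all `a, b`. -/
theorem qsystem_involution_first {N : Type*} [Ring N] [StarRing N]
    (θ : N →+* N) (hθ : ∀ a : N, θ (star a) = star (θ a))
    (w x : N)
    (hXint : ∀ a : N, x * θ a = θ (θ a) * x)
    (hAssoc : θ x * x = x * x) :
    ∀ a b : N, star x * θ (star x * θ a * b) = star x * θ a * star x * θ b := by
  intro a b
  have hAssocStar : star x * θ (star x) = star x * star x := by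
    rw [hθ, ← star_mul, hAssoc, star_mul]
  have hXintStar : star x * θ (θ a) = θ a * star x := by
    simpa only [star_mul, hθ, star_star] using (congrArg star (hXint (star a))).symm
  calc star x * θ (star x * θ a * b)
      = star x * θ (star x) * θ (θ a) * θ b := by simp only [map_mul, mul_assoc]
    _ = star x * (star x * θ (θ a)) * θ b := by rw [hAssocStar, mul_assoc (star x)]
    _ = star x * θ a * star x * θ b := by rw [hXintStar, ← mul_assoc]
end

section
/- Anti-multiplicativity of the extension involution: assume (X-int): x·θ(a) = θ(θ(a))·x for all a ∈ N, (Assoc): θ(x)·x = x·x, (Unit-R): θ(w*)·x = 1, and (Frob-L): θ(x*)·x = x·x*. Then σ(a ∘ b) = σ(b) ∘ σ(a) for all a, b ∈ N, where σ(a) := w*·x*·θ(a*) and a ∘ b := a·θ(b)·x. (This is the paper's verification that the Q-system conditions make the involution on M_A anti-multiplicative.) -/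
/-- The extension involution on `N`: `σ(a) := w*·x*·θ(a*)`. -/
def extStar {N : Type*} [Ring N] [StarRing N] (θ : N →+* N) (w x : N) (a : N) : N :=
  star w * star x * θ (star a)

/-- Anti-multiplicativity of the extension involution: assuming
(X-int) `x·θ(a) = θ(θ(a))·x`, (Assoc) `θ(x)·x = x·x`, (Unit-R) `θ(w*)·x = 1`
and (Frob-L) `θ(x*)·x = x·x*`, we have `σ(a ∘ b) = σ(b) ∘ σ(a)` for all `a, b`. -/
theorem qsystem_involution_antimultiplicative {N : Type*} [Ring N] [StarRing N]
    (θ : N →+* N) (hθ : ∀ a : N, θ (star a) = star (θ a))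
    (w x : N)
    (hXint : ∀ a : N, x * θ a = θ (θ a) * x)
    (hAssoc : θ x * x = x * x)
    (hUnitR : θ (star w) * x = 1)
    (hFrobL : θ (star x) * x = x * star x) :
    ∀ a b : N, extStar θ w x (extMul θ x a b) =
      extMul θ x (extStar θ w x b) (extStar θ w x a) := by
  intro a b
  have hAssoc' : star x * θ (star x) = star x * star x := by
    simpa [hθ] using congrArg star hAssoc
  have hXint' : star x * θ (θ (star b)) = θ (star b) * star x := by
    simpa [hθ] using (congrArg star (hXint b)).symm
  have hright : θ (star w * star x * θ (star a)) * x = star x * θ (star a) :=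
    calc θ (star w * star x * θ (star a)) * x
        = θ (star w) * θ (star x) * (θ (θ (star a)) * x) := by simp only [map_mul, mul_assoc]
      _ = θ (star w) * (θ (star x) * x) * θ (star a) := by rw [← hXint]; simp only [mul_assoc]
      _ = θ (star w) * x * (star x * θ (star a)) := by rw [hFrobL]; simp only [mul_assoc]
      _ = star x * θ (star a) := by rw [hUnitR, one_mul]
  unfold extStar extMul
  calc star w * star x * θ (star (a * θ b * x))
      = star w * (star x * θ (star x)) * θ (θ (star b)) * θ (star a) := by
        simp only [star_mul, ← hθ, map_mul, mul_assoc]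
    _ = star w * star x * (star x * θ (θ (star b))) * θ (star a) := by
        rw [hAssoc']; simp only [mul_assoc]
    _ = star w * star x * θ (star b) * (star x * θ (star a)) := by
        rw [hXint']; simp only [mul_assoc]
    _ = star w * star x * θ (star b) * θ (star w * star x * θ (star a)) * x := by
        rw [← hright]; simp only [mul_assoc]
end

section
/- Compatibility of the extension involution with the embedding: assume (W-int): w·a = θ(a)·w for all a ∈ N, and (Unit-R): θ(w*)·x = 1. Then σ(n·w*) = n*·w* for every n ∈ N, where σ(a) := w*·x*·θ(a*); in particular σ(w*) = w*. (That is, the involution of M_A restricts to the original involution on the embedded copy j(n) = n·w* of N.) -/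
/-- Compatibility of the extension involution with the embedding: assuming
(W-int) `w·a = θ(a)·w` and (Unit-R) `θ(w*)·x = 1`, we have
`σ(n·w*) = n*·w*` for every `n`; in particular `σ(w*) = w*`. -/
theorem qsystem_involution_embedding_compat {N : Type*} [Ring N] [StarRing N]
    (θ : N →+* N) (hθ : ∀ a : N, θ (star a) = star (θ a))
    (w x : N)
    (hWint : ∀ a : N, w * a = θ a * w)
    (hUnitR : θ (star w) * x = 1) :
    (∀ n : N, extStar θ w x (n * star w) = star n * star w) ∧
      extStar θ w x (star w) = star w := by
  have hx : star x * θ w = 1 := by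
    simpa [hθ] using congrArg star hUnitR
  have hw (a : N) : star w * θ a = a * star w := by
    simpa [← hθ] using (congrArg star (hWint (star a))).symm
  have hσ (n : N) : extStar θ w x (n * star w) = star n * star w := by
    rw [extStar, star_mul, star_star, map_mul, mul_assoc, ← mul_assoc (star x), hx, one_mul, hw]
  exact ⟨hσ, by simpa using hσ 1⟩
end

section
/- Key step of the Reconstruction Theorem for spatial Q-systems: let (Λᵢ)_{i∈ι} be a family of bounded operators on H such that for all i, j ∈ ι there exists n(i,j) ∈ N with W* ∘ Λᵢ ∘ Λⱼ* ∘ W = π₀(n(i,j)) (the Pimsner–Popa-type condition of a spatial Q-system). Then for every finite subset s ⊆ ι and every family (nᵢ)_{i∈ι} in N, setting m := Σ_{i∈s} Λᵢ* ∘ π(nᵢ), the operator W* ∘ m* ∘ m ∘ W lies in the range of π₀. (This shows that the map 𝒯_A(m) = W* m W sends positive elements of the extension algebra M_A = π(N) ∨ {Λᵢ*} into π₀(N), so that T_A = π₀⁻¹ ∘ 𝒯_A defines an operator-valued weight from M_A to N.) -/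
/-- Key step of the Reconstruction Theorem for spatial Q-systems: if the family of
bounded operators `(Λᵢ)` satisfies the Pimsner–Popa-type condition
`W* ∘ Λᵢ ∘ Λⱼ* ∘ W = π₀(n(i,j))`, then for every finite subset `s` and family
`(nᵢ)` in `N`, setting `m := Σ_{i∈s} Λᵢ* ∘ π(nᵢ)`, the operator `W* ∘ m* ∘ m ∘ W`
lies in the range of `π₀`. -/
theorem spatial_qsystem_reconstruction_key {H₀ H N : Type*}
    [NormedAddCommGroup H₀] [InnerProductSpace ℂ H₀] [CompleteSpace H₀]
    [NormedAddCommGroup H] [InnerProductSpace ℂ H] [CompleteSpace H]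
    [Ring N] [Algebra ℂ N] [StarRing N] [StarModule ℂ N]
    (π₀ : N →⋆ₐ[ℂ] (H₀ →L[ℂ] H₀)) (π : N →⋆ₐ[ℂ] (H →L[ℂ] H))
    (W : H₀ →L[ℂ] H)
    (hW : ∀ n : N, W ∘L π₀ n = π n ∘L W)
    {ι : Type*} (Λ : ι → (H →L[ℂ] H)) (nn : ι → ι → N)
    (hPP : ∀ i j : ι,
      ContinuousLinearMap.adjoint W ∘L Λ i ∘L ContinuousLinearMap.adjoint (Λ j) ∘L W =
        π₀ (nn i j)) :
    ∀ (s : Finset ι) (nv : ι → N) (m : H →L[ℂ] H),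
      m = ∑ i ∈ s, ContinuousLinearMap.adjoint (Λ i) ∘L π (nv i) →
      ContinuousLinearMap.adjoint W ∘L ContinuousLinearMap.adjoint m ∘L m ∘L W ∈
        Set.range ⇑π₀ := by
  rintro s nv m rfl
  have hm : (∑ i ∈ s, ContinuousLinearMap.adjoint (Λ i) ∘L π (nv i)) ∘L W =
      ∑ i ∈ s, (ContinuousLinearMap.adjoint (Λ i) ∘L W) ∘L π₀ (nv i) := by
    rw [ContinuousLinearMap.finsetSum_comp]
    refine Finset.sum_congr rfl fun i _ => ?_
    rw [ContinuousLinearMap.comp_assoc, ContinuousLinearMap.comp_assoc, hW]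
  refine ⟨∑ j ∈ s, ∑ i ∈ s, star (nv i) * nn i j * nv j, ?_⟩
  rw [← ContinuousLinearMap.comp_assoc, ← ContinuousLinearMap.adjoint_comp, hm, map_sum, map_sum,
    ContinuousLinearMap.comp_finsetSum]
  refine Finset.sum_congr rfl fun j _ => ?_
  rw [ContinuousLinearMap.finsetSum_comp, map_sum]
  refine Finset.sum_congr rfl fun i _ => ?_
  rw [map_mul, map_mul, map_star, ← hPP, ContinuousLinearMap.star_eq_adjoint,
    ContinuousLinearMap.adjoint_comp, ContinuousLinearMap.adjoint_comp,
    ContinuousLinearMap.adjoint_adjoint]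
  rfl
end
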